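/- Let ρ be a quantum state on a composite system X_1 ⊗ … ⊗ X_n ⊗ Y of finite-dimensional systems, let I ⊆ {1,…,n} with |I| = m, and let μ be an integer with 1 ≤ μ < m. Then S(X_I|Y)_ρ ≤ (m/μ) · E_{J⊆I, |J|=μ} S(X_J|Y)_ρ, where the expectation is the uniform average over all μ-element subsets J of I. -/

import Mathlib

open scoped BigOperators ComplexOrder

/-- Von Neumann entropy of a matrix: `-∑ λ_j log λ_j` over the eigenvalues,
if the matrix is Hermitian (else junk value 0). Natural logarithm,
with the convention `0 * log 0 = 0` (automatic since `Real.log 0 = 0`). -/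
noncomputable def vnEntropy {m : Type*} [Fintype m] [DecidableEq m]
    (ρ : Matrix m m ℂ) : ℝ :=
  if h : ρ.IsHermitian then
    -∑ j, h.eigenvalues j * Real.log (h.eigenvalues j)
  else 0

/-- Marginal (partial trace) of a state on the composite system
`⨂_{i : ι} X_i` (with `X_i = ℂ^{dim i}`), keeping the factors in `S`. -/
noncomputable def marginal {ι : Type*} [Fintype ι] [DecidableEq ι]
    {dim : ι → ℕ}
    (ρ : Matrix ((i : ι) → Fin (dim i)) ((i : ι) → Fin (dim i)) ℂ)
    (S : Finset ι) :
    Matrix ((i : {j : ι // j ∈ S}) → Fin (dim i.1))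
           ((i : {j : ι // j ∈ S}) → Fin (dim i.1)) ℂ :=
  fun x y =>
    ∑ z : (i : {j : ι // j ∉ S}) → Fin (dim i.1),
      ρ (fun i => if h : i ∈ S then x ⟨i, h⟩ else z ⟨i, h⟩)
        (fun i => if h : i ∈ S then y ⟨i, h⟩ else z ⟨i, h⟩)

/-- Entropy of the marginal of `ρ` on the factors in `S`. -/
noncomputable def mEnt {ι : Type*} [Fintype ι] [DecidableEq ι]
    {dim : ι → ℕ}
    (ρ : Matrix ((i : ι) → Fin (dim i)) ((i : ι) → Fin (dim i)) ℂ)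
    (S : Finset ι) : ℝ :=
  vnEntropy (marginal ρ S)


open Matrix in
/-- Variational functional. -/
noncomputable def ssaE {m : Type*} [Fintype m] (t : ℝ) (ρ σ X : Matrix m m ℂ) : ℝ :=
  2 * (Matrix.trace (Xᴴ * ρ)).re - (Matrix.trace (σ * (X * Xᴴ))).re
    - t * (Matrix.trace (ρ * (Xᴴ * X))).re

open Matrix in
theorem ssa_trace1 {m : Type*} [Fintype m] [DecidableEq m] (Y C : Matrix m m ℂ) (p : m → ℝ) :
    (Matrix.trace (Yᴴ * (C * diagonal (fun i => (p i : ℂ))))).re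
      = ∑ i, ∑ j, ((starRingEnd ℂ) (Y j i) * C j i).re * p i := by
  simp only [Matrix.trace, Matrix.diag, Matrix.mul_apply (M := Yᴴ), Matrix.mul_diagonal,
    Complex.re_sum, conjTranspose_apply]
  refine Finset.sum_congr rfl fun i _ => Finset.sum_congr rfl fun j _ => ?_
  rw [← mul_assoc, Complex.re_mul_ofReal]; rfl

open Matrix in
theorem ssa_trace2 {m : Type*} [Fintype m] [DecidableEq m] (Y : Matrix m m ℂ) (q : m → ℝ) :
    (Matrix.trace (diagonal (fun i => (q i : ℂ)) * (Y * Yᴴ))).re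
      = ∑ i, ∑ j, q j * Complex.normSq (Y j i) := by
  simp only [Matrix.trace, Matrix.diag, Matrix.diagonal_mul, Matrix.mul_apply (M := Y),
    conjTranspose_apply]
  rw [Finset.sum_comm, Complex.re_sum]
  refine Finset.sum_congr rfl fun j _ => ?_
  rw [Complex.re_ofReal_mul, Complex.re_sum, Finset.mul_sum]
  refine Finset.sum_congr rfl fun i _ => ?_
  congr 1
  have := Complex.mul_conj (Y j i)
  simp only [starRingEnd_apply] at this
  rw [this, Complex.ofReal_re]

open Matrix in
theorem ssaE_decomp {m : Type*} [Fintype m] [DecidableEq m] (t : ℝ) (U V : Matrix m m ℂ)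
    (hU : Uᴴ * U = 1) (hV : Vᴴ * V = 1) (p q : m → ℝ) (Y : Matrix m m ℂ) :
    ssaE t (U * diagonal (fun i => (p i : ℂ)) * Uᴴ) (V * diagonal (fun i => (q i : ℂ)) * Vᴴ)
      (V * Y * Uᴴ)
    = ∑ i, ∑ j, (2 * ((starRingEnd ℂ) (Y j i) * (Vᴴ * U) j i).re * p i
        - (q j + t * p i) * Complex.normSq (Y j i)) := by
  have h1 : Matrix.trace ((V * Y * Uᴴ)ᴴ * (U * diagonal (fun i => (p i : ℂ)) * Uᴴ))
      = Matrix.trace (Yᴴ * ((Vᴴ * U) * diagonal (fun i => (p i : ℂ)))) := by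
    have : (V * Y * Uᴴ)ᴴ * (U * diagonal (fun i => (p i : ℂ)) * Uᴴ)
      = U * (Yᴴ * ((Vᴴ * U) * diagonal (fun i => (p i : ℂ))) * Uᴴ) := by
      simp only [conjTranspose_mul, conjTranspose_conjTranspose, Matrix.mul_assoc]
    rw [this, Matrix.trace_mul_comm, Matrix.mul_assoc, hU, Matrix.mul_one]
  have h2 : Matrix.trace ((V * diagonal (fun i => (q i : ℂ)) * Vᴴ) *
        ((V * Y * Uᴴ) * (V * Y * Uᴴ)ᴴ))
      = Matrix.trace (diagonal (fun i => (q i : ℂ)) * (Y * Yᴴ)) := by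
    have : (V * diagonal (fun i => (q i : ℂ)) * Vᴴ) * ((V * Y * Uᴴ) * (V * Y * Uᴴ)ᴴ)
      = V * (diagonal (fun i => (q i : ℂ)) * ((Vᴴ * V) * Y * (Uᴴ * U) * Yᴴ) * Vᴴ) := by
      simp only [conjTranspose_mul, conjTranspose_conjTranspose, Matrix.mul_assoc]
    rw [this, Matrix.trace_mul_comm, hU, hV, Matrix.mul_assoc, hV]
    simp only [Matrix.mul_one, Matrix.one_mul]
  have h3 : Matrix.trace ((U * diagonal (fun i => (p i : ℂ)) * Uᴴ) *
        ((V * Y * Uᴴ)ᴴ * (V * Y * Uᴴ)))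
      = Matrix.trace (diagonal (fun i => (p i : ℂ)) * (Yᴴ * Yᴴᴴ)) := by
    have : (U * diagonal (fun i => (p i : ℂ)) * Uᴴ) * ((V * Y * Uᴴ)ᴴ * (V * Y * Uᴴ))
      = U * (diagonal (fun i => (p i : ℂ)) * ((Uᴴ * U) * Yᴴ * (Vᴴ * V) * Y) * Uᴴ) := by
      simp only [conjTranspose_mul, conjTranspose_conjTranspose, Matrix.mul_assoc]
    rw [this, Matrix.trace_mul_comm, hU, hV, Matrix.mul_assoc, hU]
    simp only [Matrix.mul_one, Matrix.one_mul, conjTranspose_conjTranspose]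
  unfold ssaE
  rw [h1, h2, h3, ssa_trace1, ssa_trace2, ssa_trace2, Finset.sum_comm (s := Finset.univ)
    (t := Finset.univ) (f := fun i j => p j * Complex.normSq (Yᴴ j i)),
    Finset.mul_sum, Finset.mul_sum, ← Finset.sum_sub_distrib, ← Finset.sum_sub_distrib]
  refine Finset.sum_congr rfl fun i _ => ?_
  rw [Finset.mul_sum, Finset.mul_sum, ← Finset.sum_sub_distrib, ← Finset.sum_sub_distrib]
  refine Finset.sum_congr rfl fun j _ => ?_
  have : Complex.normSq (Yᴴ i j) = Complex.normSq (Y j i) := by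
    rw [conjTranspose_apply]; exact Complex.normSq_conj _
  rw [this]; ring

theorem ssa_scalar_le (y c : ℂ) (p s : ℝ) (hs : 0 < s) :
    2 * ((starRingEnd ℂ) y * c).re * p - s * Complex.normSq y
      ≤ Complex.normSq c * p ^ 2 / s := by
  rw [le_div_iff₀ hs]
  simp only [Complex.mul_re, Complex.conj_re, Complex.conj_im, Complex.normSq_apply]
  nlinarith [sq_nonneg (s * y.re - c.re * p), sq_nonneg (s * y.im - c.im * p)]

theorem ssa_scalar_eq (c : ℂ) (p s : ℝ) (hs : 0 < s) :
    2 * ((starRingEnd ℂ) (((p / s : ℝ) : ℂ) * c) * c).re * p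
        - s * Complex.normSq (((p / s : ℝ) : ℂ) * c)
      = Complex.normSq c * p ^ 2 / s := by
  simp only [Complex.mul_re, Complex.conj_re, Complex.conj_im, Complex.normSq_apply,
    Complex.mul_im, Complex.ofReal_re, Complex.ofReal_im]
  field_simp
  ring

open Matrix in
/-- Monotonicity of the quadratic quasi-entropies. -/
theorem ssa_Q_mono {m n : Type*} [Fintype m] [DecidableEq m] [Fintype n] [DecidableEq n]
    (ρ σ : Matrix m m ℂ) (ρ' σ' : Matrix n n ℂ)
    (π : Matrix n n ℂ → Matrix m m ℂ)
    (hmul : ∀ X Y, π (X * Y) = π X * π Y) (hstar : ∀ X, π Xᴴ = (π X)ᴴ)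
    (hρ : ∀ X, trace (ρ * π X) = trace (ρ' * X))
    (hσ : ∀ X, trace (σ * π X) = trace (σ' * X))
    (U V : Matrix m m ℂ) (U' V' : Matrix n n ℂ)
    (hU : Uᴴ * U = 1) (hV : Vᴴ * V = 1) (hU' : U'ᴴ * U' = 1) (hV' : V'ᴴ * V' = 1)
    (p q : m → ℝ) (p' q' : n → ℝ)
    (hp : ∀ i, 0 ≤ p i) (hq : ∀ i, 0 < q i) (hp' : ∀ i, 0 ≤ p' i) (hq' : ∀ i, 0 < q' i)
    (eρ : ρ = U * diagonal (fun i => (p i : ℂ)) * Uᴴ)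
    (eσ : σ = V * diagonal (fun i => (q i : ℂ)) * Vᴴ)
    (eρ' : ρ' = U' * diagonal (fun i => (p' i : ℂ)) * U'ᴴ)
    (eσ' : σ' = V' * diagonal (fun i => (q' i : ℂ)) * V'ᴴ) (t : ℝ) (ht : 0 ≤ t) :
    ∑ i, ∑ j, Complex.normSq ((V'ᴴ * U') j i) * p' i ^ 2 / (q' j + t * p' i)
      ≤ ∑ i, ∑ j, Complex.normSq ((Vᴴ * U) j i) * p i ^ 2 / (q j + t * p i) := by
  have hs : ∀ i j, 0 < q j + t * p i := fun i j =>
    add_pos_of_pos_of_nonneg (hq j) (mul_nonneg ht (hp i))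
  have hs' : ∀ i j, 0 < q' j + t * p' i := fun i j =>
    add_pos_of_pos_of_nonneg (hq' j) (mul_nonneg ht (hp' i))
  set Y : Matrix n n ℂ := fun j i => ((p' i / (q' j + t * p' i) : ℝ) : ℂ) * (V'ᴴ * U') j i with hY
  set X := V' * Y * U'ᴴ with hX
  have e1 : ssaE t ρ' σ' X
      = ∑ i, ∑ j, Complex.normSq ((V'ᴴ * U') j i) * p' i ^ 2 / (q' j + t * p' i) := by
    rw [eρ', eσ', hX, ssaE_decomp t U' V' hU' hV']
    refine Finset.sum_congr rfl fun i _ => Finset.sum_congr rfl fun j _ => ?_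
    exact ssa_scalar_eq _ _ _ (hs' i j)
  have e2 : ssaE t ρ' σ' X = ssaE t ρ σ (π X) := by
    unfold ssaE
    rw [← hstar, ← hmul, ← hmul, hσ, hρ, Matrix.trace_mul_comm Xᴴ ρ',
      Matrix.trace_mul_comm (π Xᴴ) ρ, hρ]
  have e3 : π X = V * (Vᴴ * π X * U) * Uᴴ := by
    have a := mul_eq_one_comm.mp hU
    have b := mul_eq_one_comm.mp hV
    calc π X = (V * Vᴴ) * π X * (U * Uᴴ) := by rw [a, b]; simp
      _ = _ := by simp only [Matrix.mul_assoc]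
  rw [← e1, e2, e3, eρ, eσ, ssaE_decomp t U V hU hV]
  refine Finset.sum_le_sum fun i _ => Finset.sum_le_sum fun j _ => ?_
  exact ssa_scalar_le _ _ _ _ (hs i j)

theorem ssa_tendsto_aux (w p q : ℝ) (hp : 0 ≤ p) (hq : 0 < q) :
    Filter.Tendsto (fun T : ℝ => w * (p * (Real.log (q + T * p) - Real.log q)) - w * p * Real.log T)
      Filter.atTop (nhds (w * (p * (Real.log p - Real.log q)))) := by
  rcases hp.eq_or_lt with h | h
  · subst h; simp
  · have h1 : Filter.Tendsto (fun T : ℝ => w * (p * (Real.log (q / T + p) - Real.log q)))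
        Filter.atTop (nhds (w * (p * (Real.log p - Real.log q)))) := by
      have h0 : Filter.Tendsto (fun T : ℝ => q / T + p) Filter.atTop (nhds p) := by
        simpa using (Filter.Tendsto.const_div_atTop Filter.tendsto_id q).add_const p
      exact (((h0.log h.ne').sub_const _).const_mul p).const_mul w
    refine h1.congr' ?_
    filter_upwards [Filter.eventually_gt_atTop 0] with T hT
    have : q + T * p = T * (q / T + p) := by field_simp
    rw [this, Real.log_mul hT.ne' (by positivity)]
    ring

theorem ssa_hasDeriv_aux (w p q t : ℝ) (hp : 0 ≤ p) (hq : 0 < q) (ht : 0 ≤ t) :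
    HasDerivAt (fun T : ℝ => w * (p * (Real.log (q + T * p) - Real.log q)))
      (w * p ^ 2 / (q + t * p)) t := by
  have hs : 0 < q + t * p := add_pos_of_pos_of_nonneg hq (mul_nonneg ht hp)
  have h1 : HasDerivAt (fun T : ℝ => q + T * p) p t := by
    simpa using ((hasDerivAt_id t).mul_const p).const_add q
  have h2 := (((h1.log hs.ne').sub_const (Real.log q)).const_mul p).const_mul w
  refine h2.congr_deriv ?_
  ring

open Matrix in
theorem ssa_W_row {m : Type*} [Fintype m] [DecidableEq m] (U V : Matrix m m ℂ)
    (hU : Uᴴ * U = 1) (hV : Vᴴ * V = 1) (i : m) :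
    ∑ j, Complex.normSq ((Vᴴ * U) j i) = 1 := by
  have h : (Vᴴ * U)ᴴ * (Vᴴ * U) = 1 := by
    have b := mul_eq_one_comm.mp hV
    calc (Vᴴ * U)ᴴ * (Vᴴ * U) = Uᴴ * (V * Vᴴ) * U := by
          simp only [conjTranspose_mul, conjTranspose_conjTranspose, Matrix.mul_assoc]
      _ = 1 := by rw [b, Matrix.mul_one, hU]
  have h2 := congrFun (congrFun h i) i
  rw [Matrix.mul_apply, Matrix.one_apply_eq] at h2
  have h3 := congrArg Complex.re h2
  rw [Complex.re_sum, Complex.one_re] at h3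
  rw [← h3]
  refine Finset.sum_congr rfl fun j _ => ?_
  rw [conjTranspose_apply, Complex.star_def, ← Complex.normSq_eq_conj_mul_self, Complex.ofReal_re]

open Matrix in
theorem ssa_W_col {m : Type*} [Fintype m] [DecidableEq m] (U V : Matrix m m ℂ)
    (p : m → ℝ) (j : m) :
    ∑ i, Complex.normSq ((Vᴴ * U) j i) * p i
      = ((Vᴴ * (U * diagonal (fun i => (p i : ℂ)) * Uᴴ) * V) j j).re := by
  have h : Vᴴ * (U * diagonal (fun i => (p i : ℂ)) * Uᴴ) * V
      = (Vᴴ * U) * diagonal (fun i => (p i : ℂ)) * (Vᴴ * U)ᴴ := by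
    simp only [conjTranspose_mul, conjTranspose_conjTranspose, Matrix.mul_assoc]
  rw [h, Matrix.mul_apply, Complex.re_sum]
  refine Finset.sum_congr rfl fun i _ => ?_
  rw [Matrix.mul_diagonal, conjTranspose_apply, mul_right_comm, Complex.star_def,
    Complex.mul_conj, ← Complex.ofReal_mul, Complex.ofReal_re]

open Matrix in
theorem ssa_key {k : Type*} [Fintype k] [DecidableEq k] (U V : Matrix k k ℂ) (p q : k → ℝ)
    (hU : Uᴴ * U = 1) (hV : Vᴴ * V = 1) :
    ∑ i, ∑ j, Complex.normSq ((Vᴴ * U) j i) * (p i * (Real.log (p i) - Real.log (q j)))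
      = ∑ i, p i * Real.log (p i) -
        ∑ j, ((Vᴴ * (U * diagonal (fun i => (p i : ℂ)) * Uᴴ) * V) j j).re * Real.log (q j) := by
  simp only [mul_sub, Finset.sum_sub_distrib]
  congr 1
  · refine Finset.sum_congr rfl fun i _ => ?_
    rw [← Finset.sum_mul, ssa_W_row U V hU hV, one_mul]
  · rw [Finset.sum_comm]
    refine Finset.sum_congr rfl fun j _ => ?_
    rw [← ssa_W_col, Finset.sum_mul]
    refine Finset.sum_congr rfl fun i _ => ?_
    ring

open Matrix in
theorem ssa_key' {k : Type*} [Fintype k] [DecidableEq k] (U V : Matrix k k ℂ) (p : k → ℝ)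
    (hU : Uᴴ * U = 1) (hV : Vᴴ * V = 1) :
    ∑ i, ∑ j, Complex.normSq ((Vᴴ * U) j i) * p i
      = (trace (U * diagonal (fun i => (p i : ℂ)) * Uᴴ)).re := by
  rw [Matrix.trace_mul_comm, ← Matrix.mul_assoc, hU, Matrix.one_mul, Matrix.trace_diagonal,
    Complex.re_sum]
  refine Finset.sum_congr rfl fun i _ => ?_
  rw [← Finset.sum_mul, ssa_W_row U V hU hV, one_mul, Complex.ofReal_re]

/-- Partial relative-entropy integral. -/
noncomputable def ssaF {k : Type*} [Fintype k] (W : k → k → ℝ) (p q : k → ℝ) (T : ℝ) : ℝ :=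
  ∑ i, ∑ j, W j i * (p i * (Real.log (q j + T * p i) - Real.log (q j)))

theorem ssaF_hasDeriv {k : Type*} [Fintype k] (W : k → k → ℝ) (p q : k → ℝ)
    (hp : ∀ i, 0 ≤ p i) (hq : ∀ i, 0 < q i) (t : ℝ) (ht : 0 ≤ t) :
    HasDerivAt (ssaF W p q) (∑ i, ∑ j, W j i * p i ^ 2 / (q j + t * p i)) t := by
  unfold ssaF
  exact HasDerivAt.fun_sum fun i _ => HasDerivAt.fun_sum fun j _ =>
    ssa_hasDeriv_aux _ _ _ _ (hp i) (hq j) ht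

theorem ssaF_tendsto {k : Type*} [Fintype k] (W : k → k → ℝ) (p q : k → ℝ)
    (hp : ∀ i, 0 ≤ p i) (hq : ∀ i, 0 < q i) :
    Filter.Tendsto (fun T => ssaF W p q T - (∑ i, ∑ j, W j i * p i) * Real.log T) Filter.atTop
      (nhds (∑ i, ∑ j, W j i * (p i * (Real.log (p i) - Real.log (q j))))) := by
  have : (fun T => ssaF W p q T - (∑ i, ∑ j, W j i * p i) * Real.log T)
      = fun T => ∑ i, ∑ j, (W j i * (p i * (Real.log (q j + T * p i) - Real.log (q j)))
        - W j i * p i * Real.log T) := by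
    funext T
    simp only [ssaF, Finset.sum_mul, Finset.sum_sub_distrib]
  rw [this]
  exact tendsto_finsetSum _ fun i _ => tendsto_finsetSum _ fun j _ =>
    ssa_tendsto_aux _ _ _ (hp i) (hq j)

open Matrix in
/-- Monotonicity of the relative entropy, in spectral form. -/
theorem ssa_D_mono {m n : Type*} [Fintype m] [DecidableEq m] [Fintype n] [DecidableEq n]
    (ρ σ : Matrix m m ℂ) (ρ' σ' : Matrix n n ℂ)
    (π : Matrix n n ℂ → Matrix m m ℂ)
    (hmul : ∀ X Y, π (X * Y) = π X * π Y) (hstar : ∀ X, π Xᴴ = (π X)ᴴ) (hone : π 1 = 1)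
    (hρ : ∀ X, trace (ρ * π X) = trace (ρ' * X))
    (hσ : ∀ X, trace (σ * π X) = trace (σ' * X))
    (U V : Matrix m m ℂ) (U' V' : Matrix n n ℂ)
    (hU : Uᴴ * U = 1) (hV : Vᴴ * V = 1) (hU' : U'ᴴ * U' = 1) (hV' : V'ᴴ * V' = 1)
    (p q : m → ℝ) (p' q' : n → ℝ)
    (hp : ∀ i, 0 ≤ p i) (hq : ∀ i, 0 < q i) (hp' : ∀ i, 0 ≤ p' i) (hq' : ∀ i, 0 < q' i)
    (eρ : ρ = U * diagonal (fun i => (p i : ℂ)) * Uᴴ)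
    (eσ : σ = V * diagonal (fun i => (q i : ℂ)) * Vᴴ)
    (eρ' : ρ' = U' * diagonal (fun i => (p' i : ℂ)) * U'ᴴ)
    (eσ' : σ' = V' * diagonal (fun i => (q' i : ℂ)) * V'ᴴ) :
    ∑ i, p' i * Real.log (p' i) - ∑ j, ((V'ᴴ * ρ' * V') j j).re * Real.log (q' j)
      ≤ ∑ i, p i * Real.log (p i) - ∑ j, ((Vᴴ * ρ * V) j j).re * Real.log (q j) := by
  have hQ := ssa_Q_mono ρ σ ρ' σ' π hmul hstar hρ hσ U V U' V' hU hV hU' hV' p q p' q'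
    hp hq hp' hq' eρ eσ eρ' eσ'
  set W : m → m → ℝ := fun j i => Complex.normSq ((Vᴴ * U) j i) with hW
  set W' : n → n → ℝ := fun j i => Complex.normSq ((V'ᴴ * U') j i) with hW'
  have hder := ssaF_hasDeriv W p q hp hq
  have hder' := ssaF_hasDeriv W' p' q' hp' hq'
  have hmono : MonotoneOn (fun T => ssaF W p q T - ssaF W' p' q' T) (Set.Ici 0) := by
    refine monotoneOn_of_deriv_nonneg (convex_Ici 0) ?_ ?_ ?_
    · intro t ht
      exact ((hder t ht).sub (hder' t ht)).continuousAt.continuousWithinAt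
    · intro t ht
      rw [interior_Ici] at ht
      exact ((hder t (le_of_lt ht)).sub (hder' t (le_of_lt ht))).differentiableAt.differentiableWithinAt
    · intro t ht
      rw [interior_Ici] at ht
      have h0 : 0 ≤ t := le_of_lt ht
      have e := ((hder t h0).sub (hder' t h0)).deriv
      exact (sub_nonneg.mpr (hQ t h0)).trans_eq e.symm
  have hle : ∀ T, 0 ≤ T → ssaF W' p' q' T ≤ ssaF W p q T := by
    intro T hT
    have h := hmono (Set.mem_Ici.mpr le_rfl) (Set.mem_Ici.mpr hT) hT
    simp only [ssaF, zero_mul, add_zero, sub_self, mul_zero, Finset.sum_const_zero] at h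
    simp only [ssaF]
    linarith
  have htr : ∑ i, ∑ j, W' j i * p' i = ∑ i, ∑ j, W j i * p i := by
    have h1 := ssa_key' U V p hU hV
    have h2 := ssa_key' U' V' p' hU' hV'
    have h3 := hρ 1
    rw [hone, Matrix.mul_one, Matrix.mul_one] at h3
    rw [← eρ] at h1
    rw [← eρ'] at h2
    simp only [hW, hW']
    rw [h1, h2, h3]
  have l1 := ssaF_tendsto W p q hp hq
  have l2 := ssaF_tendsto W' p' q' hp' hq'
  have fin := le_of_tendsto_of_tendsto l2 l1 (by
    filter_upwards [Filter.eventually_ge_atTop 0] with T hT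
    rw [htr]
    exact sub_le_sub_right (hle T hT) _)
  simp only [hW, hW'] at fin
  rw [ssa_key U V p q hU hV, ssa_key U' V' p' q' hU' hV', ← eρ, ← eρ'] at fin
  exact fin

open Matrix in
theorem vnEntropy_decomp {m : Type*} [Fintype m] [DecidableEq m] (M U : Matrix m m ℂ)
    (p : m → ℝ) (hU : Uᴴ * U = 1) (e : M = U * diagonal (fun i => (p i : ℂ)) * Uᴴ) :
    vnEntropy M = - ∑ i, p i * Real.log (p i) := by
  have hM : M.IsHermitian := by
    rw [e]
    refine isHermitian_mul_mul_conjTranspose U ?_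
    rw [Matrix.IsHermitian, diagonal_conjTranspose]
    congr 1
    funext i
    simp
  have hc : M.charpoly = (diagonal (fun i => (p i : ℂ))).charpoly := by
    rw [e, Matrix.charpoly_mul_comm, ← Matrix.mul_assoc, hU, Matrix.one_mul]
  have hr := hM.roots_charpoly_eq_eigenvalues
  have hprod : (∏ i, (Polynomial.X - Polynomial.C ((p i : ℝ) : ℂ)))
      = ((Finset.univ.val.map (fun i => ((p i : ℝ) : ℂ))).map
        (fun z => Polynomial.X - Polynomial.C z)).prod := by
    rw [Multiset.map_map]; rfl
  rw [hc, charpoly_diagonal, hprod, Polynomial.roots_multiset_prod_X_sub_C] at hr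
  have h2 : ∑ j, hM.eigenvalues j * Real.log (hM.eigenvalues j) = ∑ i, p i * Real.log (p i) := by
    have h3 := congrArg (fun s : Multiset ℂ => (s.map (fun z => z.re * Real.log z.re)).sum) hr
    simp only [Multiset.map_map] at h3
    simpa using h3.symm
  rw [vnEntropy, dif_pos hM, h2]

open Matrix in
theorem ssa_spectral {m : Type*} [Fintype m] [DecidableEq m] (M : Matrix m m ℂ)
    (hM : M.PosSemidef) :
    ∃ (U : Matrix m m ℂ) (p : m → ℝ), Uᴴ * U = 1 ∧ (∀ i, 0 ≤ p i) ∧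
      M = U * diagonal (fun i => (p i : ℂ)) * Uᴴ := by
  refine ⟨hM.1.eigenvectorUnitary, hM.1.eigenvalues, ?_, hM.eigenvalues_nonneg, ?_⟩
  · exact Unitary.coe_star_mul_self hM.1.eigenvectorUnitary
  · have := hM.1.spectral_theorem
    rw [Unitary.conjStarAlgAut_apply] at this
    exact this

open Matrix in
theorem vnEntropy_submatrix {m n : Type*} [Fintype m] [DecidableEq m] [Fintype n] [DecidableEq n]
    (M : Matrix m m ℂ) (hM : M.PosSemidef) (e : n ≃ m) :
    vnEntropy (M.submatrix e e) = vnEntropy M := by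
  obtain ⟨U, p, hU, -, h⟩ := ssa_spectral M hM
  rw [vnEntropy_decomp M U p hU h,
    vnEntropy_decomp (M.submatrix e e) (U.submatrix e e) (p ∘ e) ?_ ?_]
  · congr 1
    exact Equiv.sum_comp e (fun i => p i * Real.log (p i))
  · rw [conjTranspose_submatrix, submatrix_mul_equiv, hU, submatrix_one_equiv]
  · have : diagonal (fun i => (((p ∘ e) i : ℝ) : ℂ))
        = (diagonal (fun i => (p i : ℂ))).submatrix e e := by
      rw [submatrix_diagonal_equiv]; rfl
    rw [conjTranspose_submatrix, this, submatrix_mul_equiv, submatrix_mul_equiv, ← h]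

/-- Trace out the second factor. -/
noncomputable def ptrC {s c : Type*} [Fintype c] (R : Matrix (s × c) (s × c) ℂ) : Matrix s s ℂ :=
  fun x y => ∑ z, R (x, z) (y, z)

/-- Trace out the first factor of three. -/
noncomputable def ptrA {a b c : Type*} [Fintype a] (R : Matrix ((a × b) × c) ((a × b) × c) ℂ) :
    Matrix (b × c) (b × c) ℂ :=
  fun u v => ∑ x, R ((x, u.1), u.2) ((x, v.1), v.2)

theorem ptrC_psd {s c : Type*} [Fintype s] [Fintype c] (R : Matrix (s × c) (s × c) ℂ)
    (h : R.PosSemidef) : (ptrC R).PosSemidef := by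
  have : ptrC R = ∑ z, R.submatrix (fun x => (x, z)) (fun x => (x, z)) := by
    ext x y
    simp [ptrC, Matrix.sum_apply]
  rw [this]
  exact Matrix.posSemidef_sum _ fun z _ => h.submatrix _

theorem ptrA_psd {a b c : Type*} [Fintype a] [Fintype b] [Fintype c]
    (R : Matrix ((a × b) × c) ((a × b) × c) ℂ)
    (h : R.PosSemidef) : (ptrA R).PosSemidef := by
  have : ptrA R = ∑ x, R.submatrix (fun u : b × c => ((x, u.1), u.2)) (fun u => ((x, u.1), u.2)) := by
    ext u v
    simp [ptrA, Matrix.sum_apply]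
  rw [this]
  exact Matrix.posSemidef_sum _ fun z _ => h.submatrix _

open Matrix Kronecker in
theorem ssa_ptrC_diag {s c : Type*} [Fintype s] [DecidableEq s] [Fintype c] [DecidableEq c]
    (R : Matrix (s × c) (s × c) ℂ) (A : Matrix s s ℂ) (j : s) :
    ∑ z, ((A ⊗ₖ (1 : Matrix c c ℂ))ᴴ * R * (A ⊗ₖ (1 : Matrix c c ℂ))) (j, z) (j, z)
      = (Aᴴ * ptrC R * A) j j := by
  simp only [Matrix.mul_apply, conjTranspose_kronecker, conjTranspose_one, kroneckerMap_apply,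
    Fintype.sum_prod_type, ptrC, Matrix.one_apply, mul_ite, ite_mul, mul_one, mul_zero, zero_mul,
    Finset.sum_ite_eq, Finset.sum_ite_eq', Finset.mem_univ, if_true]
  rw [Finset.sum_comm]
  refine Finset.sum_congr rfl fun x _ => ?_
  rw [← Finset.sum_mul, Finset.sum_comm]
  congr 1
  refine Finset.sum_congr rfl fun y _ => ?_
  rw [Finset.mul_sum]

open Matrix Kronecker in
/-- Embedding `X ↦ 1 ⊗ X`. -/
noncomputable def ssaPi {a b c : Type*} [DecidableEq a]
    (X : Matrix (b × c) (b × c) ℂ) : Matrix ((a × b) × c) ((a × b) × c) ℂ :=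
  ((1 : Matrix a a ℂ) ⊗ₖ X).submatrix (Equiv.prodAssoc a b c) (Equiv.prodAssoc a b c)

open Matrix in
theorem ssaPi_trace {a b c : Type*} [Fintype a] [DecidableEq a] [Fintype b] [Fintype c]
    (R : Matrix ((a × b) × c) ((a × b) × c) ℂ) (X : Matrix (b × c) (b × c) ℂ) :
    trace (R * ssaPi X) = trace (ptrA R * X) := by
  simp only [trace, Matrix.diag, Matrix.mul_apply, ssaPi, submatrix_apply, kroneckerMap_apply,
    Fintype.sum_prod_type, Equiv.prodAssoc_apply, Matrix.one_apply, ite_mul, one_mul, zero_mul,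
    mul_ite, mul_zero, ptrA, Finset.sum_mul]
  have : ∀ (x : a) (y : b) (z : c), (∑ x' : a, ∑ y' : b, ∑ z' : c,
      if x' = x then R ((x, y), z) ((x', y'), z') * X (y', z') (y, z) else 0)
      = ∑ y', ∑ z', R ((x, y), z) ((x, y'), z') * X (y', z') (y, z) := by
    intro x y z
    rw [Finset.sum_eq_single x]
    · simp
    · intro x' _ h; simp [h]
    · simp
  simp only [this]
  rw [Finset.sum_comm]
  refine Finset.sum_congr rfl fun y _ => ?_
  rw [Finset.sum_comm]
  refine Finset.sum_congr rfl fun z _ => ?_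
  rw [Finset.sum_comm]
  refine Finset.sum_congr rfl fun y' _ => ?_
  rw [Finset.sum_comm]

open Matrix Kronecker in
theorem ssa_kron_decomp {s c : Type*} [Fintype s] [DecidableEq s] [Fintype c] [DecidableEq c]
    (M A : Matrix s s ℂ) (l : s → ℝ) (ε : ℝ) (hA : Aᴴ * A = 1)
    (e : M = A * diagonal (fun i => (l i : ℂ)) * Aᴴ) :
    (A ⊗ₖ (1 : Matrix c c ℂ))ᴴ * (A ⊗ₖ (1 : Matrix c c ℂ)) = 1 ∧
    (M + (ε : ℂ) • 1) ⊗ₖ (1 : Matrix c c ℂ) = (A ⊗ₖ (1 : Matrix c c ℂ)) *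
      diagonal (fun i : s × c => ((l i.1 + ε : ℝ) : ℂ)) * (A ⊗ₖ (1 : Matrix c c ℂ))ᴴ := by
  constructor
  · rw [conjTranspose_kronecker, ← mul_kronecker_mul, hA, conjTranspose_one, one_mul,
      one_kronecker_one]
  · have h1 : diagonal (fun i : s × c => ((l i.1 + ε : ℝ) : ℂ))
        = diagonal (fun i : s => ((l i + ε : ℝ) : ℂ)) ⊗ₖ (1 : Matrix c c ℂ) := by
      rw [← diagonal_one, diagonal_kronecker_diagonal]; simp
    have h2 : M + (ε : ℂ) • 1 = A * diagonal (fun i : s => ((l i + ε : ℝ) : ℂ)) * Aᴴ := by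
      have h3 : diagonal (fun i : s => ((l i + ε : ℝ) : ℂ))
          = diagonal (fun i : s => (l i : ℂ)) + (ε : ℂ) • 1 := by
        rw [← diagonal_one, ← diagonal_smul, diagonal_add]
        congr 1; funext i; simp
      rw [h3, Matrix.mul_add, Matrix.add_mul, ← e, Matrix.mul_smul, Matrix.smul_mul, Matrix.mul_one,
        mul_eq_one_comm.mp hA]
    rw [h1, h2, conjTranspose_kronecker, conjTranspose_one, ← mul_kronecker_mul,
      ← mul_kronecker_mul, one_mul, one_mul]

open Matrix Kronecker in
theorem ssa_cross {s c : Type*} [Fintype s] [DecidableEq s] [Fintype c] [DecidableEq c]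
    (R : Matrix (s × c) (s × c) ℂ) (A : Matrix s s ℂ) (l : s → ℝ) (ε : ℝ) (hA : Aᴴ * A = 1)
    (e : ptrC R = A * diagonal (fun i => (l i : ℂ)) * Aᴴ) :
    ∑ j : s × c, (((A ⊗ₖ (1 : Matrix c c ℂ))ᴴ * R * (A ⊗ₖ (1 : Matrix c c ℂ))) j j).re
      * Real.log (l j.1 + ε) = ∑ i, l i * Real.log (l i + ε) := by
  rw [Fintype.sum_prod_type]
  refine Finset.sum_congr rfl fun i _ => ?_
  have hs := Finset.sum_mul (Finset.univ : Finset c) (fun z =>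
    (((A ⊗ₖ (1 : Matrix c c ℂ))ᴴ * R * (A ⊗ₖ (1 : Matrix c c ℂ))) (i, z) (i, z)).re)
    (Real.log (l i + ε))
  refine hs.symm.trans ?_
  rw [← Complex.re_sum, ssa_ptrC_diag, e]
  have : Aᴴ * (A * diagonal (fun i => (l i : ℂ)) * Aᴴ) * A
      = (Aᴴ * A) * diagonal (fun i => (l i : ℂ)) * (Aᴴ * A) := by
    simp only [Matrix.mul_assoc]
  rw [this, hA]
  simp

theorem ssa_eps_tendsto {s : Type*} [Fintype s] (l : s → ℝ) (d : ℝ) :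
    Filter.Tendsto (fun ε : ℝ => ∑ i, l i * Real.log (l i + ε * d)) (nhdsWithin 0 (Set.Ioi 0))
      (nhds (∑ i, l i * Real.log (l i))) := by
  refine tendsto_finsetSum _ fun i _ => ?_
  by_cases h : l i = 0
  · simp [h]
  · have h0 : Filter.Tendsto (fun ε : ℝ => l i + ε * d) (nhds 0) (nhds (l i)) := by
      have : Continuous (fun ε : ℝ => l i + ε * d) := by fun_prop
      simpa using this.tendsto 0
    exact ((h0.log h).const_mul (l i)).mono_left nhdsWithin_le_nhds

open Matrix Kronecker in
/-- Strong subadditivity of the von Neumann entropy. -/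
theorem ssa_prod {a b c : Type*} [Fintype a] [DecidableEq a] [Fintype b] [DecidableEq b]
    [Fintype c] [DecidableEq c] [Nonempty a]
    (R : Matrix ((a × b) × c) ((a × b) × c) ℂ) (hR : R.PosSemidef) :
    vnEntropy R + vnEntropy (ptrC (ptrA R)) ≤ vnEntropy (ptrC R) + vnEntropy (ptrA R) := by
  obtain ⟨U, p, hU, hp, e⟩ := ssa_spectral R hR
  obtain ⟨U', p', hU', hp', e'⟩ := ssa_spectral _ (ptrA_psd R hR)
  obtain ⟨A, l, hA, hl, eA⟩ := ssa_spectral _ (ptrC_psd R hR)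
  obtain ⟨B, k, hB, hk, eB⟩ := ssa_spectral _ (ptrC_psd _ (ptrA_psd R hR))
  rw [vnEntropy_decomp _ U p hU e, vnEntropy_decomp _ U' p' hU' e', vnEntropy_decomp _ A l hA eA,
    vnEntropy_decomp _ B k hB eB]
  have hd : (0 : ℝ) < Fintype.card a := by exact_mod_cast Fintype.card_pos
  have main : ∀ ε : ℝ, 0 < ε →
      ∑ i, p' i * Real.log (p' i) - ∑ i, k i * Real.log (k i + ε * Fintype.card a)
      ≤ ∑ i, p i * Real.log (p i) - ∑ i, l i * Real.log (l i + ε * 1) := by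
    intro ε hε
    rw [mul_one]
    have k1 := ssa_kron_decomp (c := c) _ A l ε hA eA
    have k2 := ssa_kron_decomp (c := c) _ B k (ε * Fintype.card a) hB eB
    rw [← ssa_cross (ptrA R) B k (ε * Fintype.card a) hB eB, ← ssa_cross R A l ε hA eA]
    refine ssa_D_mono R _ (ptrA R) _ ssaPi ?_ ?_ ?_ (ssaPi_trace R) ?_ U _ U' _ hU k1.1 hU' k2.1
      p (fun i => l i.1 + ε) p' (fun i => k i.1 + ε * Fintype.card a) hp ?_ hp' ?_ e k1.2 e' k2.2
    · intro X Y
      simp only [ssaPi]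
      rw [submatrix_mul_equiv, ← mul_kronecker_mul, one_mul]
    · intro X
      simp only [ssaPi]
      rw [conjTranspose_submatrix, conjTranspose_kronecker, conjTranspose_one]
    · simp only [ssaPi]
      rw [one_kronecker_one, submatrix_one_equiv]
    · intro X
      rw [ssaPi_trace]
      congr 2
      ext ⟨y, z⟩ ⟨y', z'⟩
      simp only [ptrA, ptrC, kroneckerMap_apply, Matrix.add_apply, Matrix.smul_apply,
        Matrix.one_apply]
      have hc : ∑ x, ∑ z, R ((x, y), z) ((x, y'), z) = ∑ z, ∑ x, R ((x, y), z) ((x, y'), z) :=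
        Finset.sum_comm
      by_cases hz : z = z'
      · by_cases h : y = y'
        · subst h
          simp [hz, Finset.sum_add_distrib, hc, mul_comm]
        · simp [hz, h, hc]
      · simp [hz]
    · intro i
      exact add_pos_of_nonneg_of_pos (hl _) hε
    · intro i
      exact add_pos_of_nonneg_of_pos (hk _) (mul_pos hε hd)
  have l1 := (ssa_eps_tendsto k (Fintype.card a)).const_sub (∑ i, p' i * Real.log (p' i))
  have l2 := (ssa_eps_tendsto l 1).const_sub (∑ i, p i * Real.log (p i))
  have fin := le_of_tendsto_of_tendsto l1 l2 (by
    filter_upwards [self_mem_nhdsWithin] with ε hε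
    exact main ε hε)
  linarith

/-- Glueing dependent functions on complementary predicates. -/
def glueEquiv {ι : Type*} {F : ι → Type*} (P Q S : ι → Prop) [DecidablePred P]
    (hS : ∀ i, S i ↔ P i ∨ Q i) (hd : ∀ i, P i → ¬ Q i) :
    (((i : {j // P j}) → F i.1) × ((i : {j // Q j}) → F i.1)) ≃ ((i : {j // S j}) → F i.1) where
  toFun u := fun i => if h : P i.1 then u.1 ⟨i.1, h⟩
    else u.2 ⟨i.1, ((hS i.1).1 i.2).resolve_left h⟩
  invFun w := (fun i => w ⟨i.1, (hS _).2 (Or.inl i.2)⟩, fun i => w ⟨i.1, (hS _).2 (Or.inr i.2)⟩)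
  left_inv u := by
    obtain ⟨u, v⟩ := u
    refine Prod.ext ?_ ?_
    · funext i
      simp [i.2]
    · funext i
      have : ¬ P i.1 := fun h => hd _ h i.2
      simp [this]
  right_inv w := by
    funext i
    by_cases h : P i.1 <;> simp [h]

theorem marginal_psd {ι : Type*} [Fintype ι] [DecidableEq ι] {dim : ι → ℕ}
    (ρ : Matrix ((i : ι) → Fin (dim i)) ((i : ι) → Fin (dim i)) ℂ) (hρ : ρ.PosSemidef)
    (S : Finset ι) : (marginal ρ S).PosSemidef := by
  have : marginal ρ S = ∑ z : (i : {j : ι // j ∉ S}) → Fin (dim i.1),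
      ρ.submatrix (fun x i => if h : i ∈ S then x ⟨i, h⟩ else z ⟨i, h⟩)
        (fun x i => if h : i ∈ S then x ⟨i, h⟩ else z ⟨i, h⟩) := by
    ext x y
    simp [marginal, Matrix.sum_apply]
  rw [this]
  exact Matrix.posSemidef_sum _ fun z _ => hρ.submatrix _

theorem mEnt_eq {ι : Type*} [Fintype ι] [DecidableEq ι] {dim : ι → ℕ}
    (ρ : Matrix ((i : ι) → Fin (dim i)) ((i : ι) → Fin (dim i)) ℂ) (hρ : ρ.PosSemidef)
    (S : Finset ι) {α β : Type*} [Fintype α] [DecidableEq α] [Fintype β]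
    (eS : α ≃ ((i : {j : ι // j ∈ S}) → Fin (dim i.1)))
    (eN : β ≃ ((i : {j : ι // j ∉ S}) → Fin (dim i.1)))
    (g : α → β → (i : ι) → Fin (dim i))
    (hg : ∀ a b i, g a b i = if h : i ∈ S then eS a ⟨i, h⟩ else eN b ⟨i, h⟩)
    (M : Matrix α α ℂ) (hM : ∀ a a', M a a' = ∑ b, ρ (g a b) (g a' b)) :
    mEnt ρ S = vnEntropy M := by
  have : M = (marginal ρ S).submatrix eS eS := by
    ext a a'
    rw [hM, Matrix.submatrix_apply, marginal, ← Equiv.sum_comp eN]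
    refine Finset.sum_congr rfl fun b _ => ?_
    rw [funext (hg a b), funext (hg a' b)]
  rw [this, vnEntropy_submatrix _ (marginal_psd ρ hρ S), mEnt]

theorem ssa_mEnt {ι : Type*} [Fintype ι] [DecidableEq ι] {dim : ι → ℕ}
    (ρ : Matrix ((i : ι) → Fin (dim i)) ((i : ι) → Fin (dim i)) ℂ) (hρ : ρ.PosSemidef)
    (hne : Nonempty ((i : ι) → Fin (dim i)))
    (A B C : Finset ι) (hAB : Disjoint A B) (hAC : Disjoint A C) (hBC : Disjoint B C) :
    mEnt ρ (A ∪ B ∪ C) + mEnt ρ B ≤ mEnt ρ (A ∪ B) + mEnt ρ (B ∪ C) := by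
  have dAB : ∀ i, i ∈ A → i ∉ B := fun i h h' => Finset.disjoint_left.mp hAB h h'
  have dAC : ∀ i, i ∈ A → i ∉ C := fun i h h' => Finset.disjoint_left.mp hAC h h'
  have dBC : ∀ i, i ∈ B → i ∉ C := fun i h h' => Finset.disjoint_left.mp hBC h h'
  have hneA : Nonempty ((i : {j // j ∈ A}) → Fin (dim i.1)) := hne.map fun w i => w i.1
  let g : ((((i : {j // j ∈ A}) → Fin (dim i.1)) × ((i : {j // j ∈ B}) → Fin (dim i.1))) ×
      ((i : {j // j ∈ C}) → Fin (dim i.1))) → ((i : {j // j ∉ A ∪ B ∪ C}) → Fin (dim i.1)) →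
      (i : ι) → Fin (dim i) := fun u z i =>
    if hA : i ∈ A then u.1.1 ⟨i, hA⟩ else if hB : i ∈ B then u.1.2 ⟨i, hB⟩ else
      if hC : i ∈ C then u.2 ⟨i, hC⟩ else z ⟨i, by simp [hA, hB, hC]⟩
  let R : Matrix ((((i : {j // j ∈ A}) → Fin (dim i.1)) × ((i : {j // j ∈ B}) → Fin (dim i.1))) ×
      ((i : {j // j ∈ C}) → Fin (dim i.1))) ((((i : {j // j ∈ A}) → Fin (dim i.1)) ×
      ((i : {j // j ∈ B}) → Fin (dim i.1))) × ((i : {j // j ∈ C}) → Fin (dim i.1))) ℂ :=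
    fun u v => ∑ z, ρ (g u z) (g v z)
  have hR : R.PosSemidef := by
    have : R = ∑ z, ρ.submatrix (fun u => g u z) (fun u => g u z) := by
      ext u v
      simp [R, Matrix.sum_apply]
    rw [this]
    exact Matrix.posSemidef_sum _ fun z _ => hρ.submatrix _
  let eAB := glueEquiv (F := fun i => Fin (dim i)) (fun i => i ∈ A) (fun i => i ∈ B)
    (fun i => i ∈ A ∪ B) (fun i => Finset.mem_union) dAB
  let eBC := glueEquiv (F := fun i => Fin (dim i)) (fun i => i ∈ B) (fun i => i ∈ C)
    (fun i => i ∈ B ∪ C) (fun i => Finset.mem_union) dBC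
  let eABC := glueEquiv (F := fun i => Fin (dim i)) (fun i => i ∈ A ∪ B) (fun i => i ∈ C)
    (fun i => i ∈ A ∪ B ∪ C) (fun i => Finset.mem_union) (by
      intro i h; rcases Finset.mem_union.mp h with h | h
      · exact dAC i h
      · exact dBC i h)
  let nAB := glueEquiv (F := fun i => Fin (dim i)) (fun i => i ∈ C) (fun i => i ∉ A ∪ B ∪ C)
    (fun i => i ∉ A ∪ B) (by intro i; have := dAC i; have := dBC i; simp only [Finset.mem_union]; tauto)
    (by intro i; simp only [Finset.mem_union]; tauto)
  let nBC := glueEquiv (F := fun i => Fin (dim i)) (fun i => i ∈ A) (fun i => i ∉ A ∪ B ∪ C)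
    (fun i => i ∉ B ∪ C) (by intro i; have := dAC i; have := dAB i; simp only [Finset.mem_union]; tauto)
    (by intro i; simp only [Finset.mem_union]; tauto)
  let nB := glueEquiv (F := fun i => Fin (dim i)) (fun i => i ∈ C) (fun i => i ∉ B ∪ C)
    (fun i => i ∉ B) (by intro i; have := dBC i; simp only [Finset.mem_union]; tauto)
    (by intro i; simp only [Finset.mem_union]; tauto)
  have h1 : mEnt ρ (A ∪ B ∪ C) = vnEntropy R := by
    refine mEnt_eq ρ hρ _ ((Equiv.prodCongr eAB (Equiv.refl _)).trans eABC) (Equiv.refl _) g ?_ R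
      (fun _ _ => rfl)
    intro u z i
    by_cases hA : i ∈ A <;> by_cases hB : i ∈ B <;> by_cases hC : i ∈ C <;>
      simp [g, eAB, eABC, glueEquiv, hA, hB, hC]
  have h2 : mEnt ρ (A ∪ B) = vnEntropy (ptrC R) := by
    refine mEnt_eq ρ hρ _ eAB nAB (fun u w => g (u, w.1) w.2) ?_ _ ?_
    · intro u w i
      by_cases hA : i ∈ A <;> by_cases hB : i ∈ B <;> by_cases hC : i ∈ C <;>
        simp [g, eAB, nAB, glueEquiv, hA, hB, hC]
    · intro u v
      simp only [ptrC, R, Fintype.sum_prod_type]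
  have h3 : mEnt ρ (B ∪ C) = vnEntropy (ptrA R) := by
    refine mEnt_eq ρ hρ _ eBC nBC (fun u w => g ((w.1, u.1), u.2) w.2) ?_ _ ?_
    · intro u w i
      by_cases hA : i ∈ A
      · simp [g, eBC, nBC, glueEquiv, hA, dAB i hA, dAC i hA]
      · by_cases hB : i ∈ B <;> by_cases hC : i ∈ C <;>
          simp [g, eBC, nBC, glueEquiv, hA, hB, hC]
    · intro u v
      simp only [ptrA, R, Fintype.sum_prod_type]
  have h4 : mEnt ρ B = vnEntropy (ptrC (ptrA R)) := by
    refine mEnt_eq ρ hρ _ (Equiv.refl _) ((Equiv.prodCongr (Equiv.refl _) nBC).trans nB)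
      (fun y w => g ((w.2.1, y), w.1) w.2.2) ?_ _ ?_
    · intro u w i
      by_cases hA : i ∈ A
      · simp [g, nB, nBC, glueEquiv, hA, dAB i hA, dAC i hA]
      · by_cases hB : i ∈ B <;> by_cases hC : i ∈ C <;>
          simp [g, nB, nBC, glueEquiv, hA, hB, hC]
    · intro u v
      simp only [ptrC, ptrA, R, Fintype.sum_prod_type]
  rw [h1, h2, h3, h4]
  exact ssa_prod R hR

/-- A submodular function has a point in its base polytope. -/
theorem submod_base {α : Type*} [DecidableEq α] (g : Finset α → ℝ) (h0 : g ∅ = 0)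
    (hsub : ∀ (J I : Finset α) (a : α), J ⊆ I → a ∉ I →
      g (insert a I) + g J ≤ g (insert a J) + g I) (I : Finset α) :
    ∃ δ : α → ℝ, ∑ i ∈ I, δ i = g I ∧ ∀ J, J ⊆ I → ∑ i ∈ J, δ i ≤ g J := by
  induction I using Finset.induction_on with
  | empty =>
    refine ⟨fun _ => 0, by simp [h0], fun J hJ => ?_⟩
    rw [Finset.subset_empty.mp hJ]; simp [h0]
  | insert a I ha ih =>
    obtain ⟨δ, h1, h2⟩ := ih
    have hcong : ∀ J ⊆ I, ∑ i ∈ J, Function.update δ a (g (insert a I) - g I) i = ∑ i ∈ J, δ i := by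
      intro J hJ
      refine Finset.sum_congr rfl fun i hi => ?_
      rw [Function.update_of_ne]
      rintro rfl
      exact ha (hJ hi)
    refine ⟨Function.update δ a (g (insert a I) - g I), ?_, fun J hJ => ?_⟩
    · rw [Finset.sum_insert ha, hcong I subset_rfl, h1, Function.update_self]; ring
    · by_cases haJ : a ∈ J
      · have hs : J.erase a ⊆ I := by
          intro i hi
          rw [Finset.mem_erase] at hi
          exact (Finset.mem_insert.mp (hJ hi.2)).resolve_left hi.1
        have h3 := h2 _ hs
        have h4 := hsub _ _ a hs ha
        rw [Finset.insert_erase haJ] at h4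
        rw [← Finset.add_sum_erase _ _ haJ, hcong _ hs, Function.update_self]
        linarith
      · have hs : J ⊆ I := fun i hi =>
          (Finset.mem_insert.mp (hJ hi)).resolve_left (fun h => haJ (h ▸ hi))
        rw [hcong J hs]
        exact h2 J hs

theorem sum_powersetCard_sum {α : Type*} [DecidableEq α] (I : Finset α) (k : ℕ) (δ : α → ℝ) :
    ∑ J ∈ Finset.powersetCard (k + 1) I, ∑ i ∈ J, δ i
      = ((I.card - 1).choose k : ℝ) * ∑ i ∈ I, δ i := by
  have h1 : ∀ J ∈ Finset.powersetCard (k + 1) I,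
      ∑ i ∈ J, δ i = ∑ i ∈ I, if i ∈ J then δ i else 0 := by
    intro J hJ
    rw [← Finset.sum_filter]
    congr 1
    ext i
    simp only [Finset.mem_filter]
    exact ⟨fun h => ⟨(Finset.mem_powersetCard.mp hJ).1 h, h⟩, fun h => h.2⟩
  rw [Finset.sum_congr rfl h1, Finset.sum_comm, Finset.mul_sum]
  refine Finset.sum_congr rfl fun i hi => ?_
  rw [← Finset.sum_filter, Finset.sum_const, nsmul_eq_mul]
  congr 2
  rw [← Finset.card_erase_of_mem hi, ← Finset.card_powersetCard]
  refine Finset.card_bij' (fun J _ => J.erase i) (fun J _ => insert i J) ?_ ?_ ?_ ?_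
  · intro J hJ
    simp only [Finset.mem_filter, Finset.mem_powersetCard] at hJ ⊢
    exact ⟨Finset.erase_subset_erase _ hJ.1.1, by rw [Finset.card_erase_of_mem hJ.2, hJ.1.2]; rfl⟩
  · intro J hJ
    simp only [Finset.mem_filter, Finset.mem_powersetCard] at hJ ⊢
    have hni : i ∉ J := fun h => (Finset.mem_erase.mp (hJ.1 h)).1 rfl
    refine ⟨⟨?_, by rw [Finset.card_insert_of_notMem hni, hJ.2]⟩, Finset.mem_insert_self _ _⟩
    exact Finset.insert_subset hi (hJ.1.trans (Finset.erase_subset _ _))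
  · intro J hJ
    simp only [Finset.mem_filter] at hJ
    exact Finset.insert_erase hJ.2
  · intro J hJ
    simp only [Finset.mem_powersetCard] at hJ
    exact Finset.erase_insert fun h => (Finset.mem_erase.mp (hJ.1 h)).1 rfl

/-- for a fixed `I` with `|I| = m` and `1 ≤ μ < m`,
`S(X_I|Y) ≤ (m/μ) E_{J ⊆ I, |J|=μ} S(X_J|Y)`. -/
theorem cond_entropy_sub_subsets
    (n m μ : ℕ) (hμ : 1 ≤ μ) (hμm : μ < m)
    (dim : Fin n ⊕ Unit → ℕ)
    (ρ : Matrix ((i : Fin n ⊕ Unit) → Fin (dim i))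
                ((i : Fin n ⊕ Unit) → Fin (dim i)) ℂ)
    (hpsd : ρ.PosSemidef) (htr : ρ.trace = 1)
    (I : Finset (Fin n)) (hI : I.card = m) :
    mEnt ρ (I.image Sum.inl ∪ ({Sum.inr ()} : Finset (Fin n ⊕ Unit)))
        - mEnt ρ ({Sum.inr ()} : Finset (Fin n ⊕ Unit))
      ≤ (m : ℝ) / (μ : ℝ) *
        ((∑ J ∈ Finset.powersetCard μ I,
          (mEnt ρ (J.image Sum.inl ∪ ({Sum.inr ()} : Finset (Fin n ⊕ Unit)))
            - mEnt ρ ({Sum.inr ()} : Finset (Fin n ⊕ Unit))))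
          / (m.choose μ : ℝ)) := by
  have hne : Nonempty ((i : Fin n ⊕ Unit) → Fin (dim i)) := by
    by_contra h
    rw [not_nonempty_iff] at h
    simp [Matrix.trace] at htr
  set Y : Finset (Fin n ⊕ Unit) := {Sum.inr ()} with hY
  set g : Finset (Fin n) → ℝ := fun J => mEnt ρ (J.image Sum.inl ∪ Y) - mEnt ρ Y with hg
  have h0 : g ∅ = 0 := by simp [hg]
  have hsub : ∀ (J I : Finset (Fin n)) (a : Fin n), J ⊆ I → a ∉ I →
      g (insert a I) + g J ≤ g (insert a J) + g I := by
    intro J I a hJ ha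
    have key := ssa_mEnt ρ hpsd hne {Sum.inl a} (J.image Sum.inl ∪ Y) ((I \ J).image Sum.inl)
      (by
        have := fun h => ha (hJ h)
        simpa [hY] using this)
      (by simp [ha])
      (by
        rw [Finset.disjoint_left]
        intro x hx hx'
        simp only [hY, Finset.mem_union, Finset.mem_image, Finset.mem_singleton,
          Finset.mem_sdiff] at hx hx'
        obtain ⟨y, hy, rfl⟩ := hx'
        simp at hx
        exact hy.2 hx)
    have e2 : ({Sum.inl a} : Finset (Fin n ⊕ Unit)) ∪ (J.image Sum.inl ∪ Y)
        = (insert a J).image Sum.inl ∪ Y := by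
      rw [Finset.image_insert, ← Finset.union_assoc]; rfl
    have e3 : (J.image Sum.inl ∪ Y) ∪ (I \ J).image Sum.inl = I.image Sum.inl ∪ Y := by
      rw [Finset.union_right_comm, ← Finset.image_union, Finset.union_sdiff_of_subset hJ]
    have e1 : ({Sum.inl a} : Finset (Fin n ⊕ Unit)) ∪ (J.image Sum.inl ∪ Y) ∪
        (I \ J).image Sum.inl = (insert a I).image Sum.inl ∪ Y := by
      rw [Finset.union_assoc, e3, Finset.image_insert, ← Finset.union_assoc]; rfl
    rw [e1, e2, e3] at key
    simp only [hg]
    linarith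
  obtain ⟨δ, h1, h2⟩ := submod_base g h0 hsub I
  obtain ⟨k, rfl⟩ : ∃ k, μ = k + 1 := ⟨μ - 1, by omega⟩
  obtain ⟨l, rfl⟩ : ∃ l, m = l + 1 := ⟨m - 1, by omega⟩
  have hs : (l.choose k : ℝ) * g I ≤ ∑ J ∈ Finset.powersetCard (k + 1) I, g J := by
    have := sum_powersetCard_sum I k δ
    rw [hI, h1, Nat.add_sub_cancel] at this
    rw [← this]
    exact Finset.sum_le_sum fun J hJ => h2 J (Finset.mem_powersetCard.mp hJ).1
  have hch : ((l + 1 : ℕ) : ℝ) * (l.choose k : ℝ)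
      = ((l + 1).choose (k + 1) : ℝ) * ((k + 1 : ℕ) : ℝ) := by
    exact_mod_cast Nat.add_one_mul_choose_eq l k
  have hpos : (0 : ℝ) < ((l + 1).choose (k + 1) : ℝ) := by
    exact_mod_cast Nat.choose_pos (by omega)
  have hk : (0 : ℝ) < ((k + 1 : ℕ) : ℝ) := by positivity
  change g I ≤ ((l + 1 : ℕ) : ℝ) / ((k + 1 : ℕ) : ℝ) *
    ((∑ J ∈ Finset.powersetCard (k + 1) I, g J) / ((l + 1).choose (k + 1) : ℝ))
  rw [div_mul_div_comm, le_div_iff₀ (mul_pos hk hpos), mul_comm ((k + 1 : ℕ) : ℝ), ← hch]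
  have := mul_le_mul_of_nonneg_left hs (Nat.cast_nonneg (α := ℝ) (l + 1))
  linarith
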